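/- Let (A,·) be an anti-flexible algebra and N : A → A a Nijenhuis operator, and let k, l be natural numbers. Then N^l is a Nijenhuis operator on the anti-flexible algebra (A, ·_{N^k}), and the deformation of the product ·_{N^k} by N^l coincides with ·_{N^{k+l}}, i.e. (a ·_{N^k})_{N^l} b = a ·_{N^{k+l}} b for all a, b ∈ A (in particular (A, ·_{N^k}) is an anti-flexible algebra). -/

import Mathlib

/-- The anti-flexible identity for a (bilinear) product. -/
def AntiFlexible {A : Type*} [AddCommGroup A] (mul : A → A → A) : Prop :=
  ∀ a b c : A, mul (mul a b) c - mul a (mul b c) = mul (mul c b) a - mul c (mul b a)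

/-- Nijenhuis operator on `(A, mul)`. -/
def IsNijenhuis {A : Type*} [AddCommGroup A] (mul : A → A → A) (N : A → A) : Prop :=
  ∀ a b : A, mul (N a) (N b) = N (mul (N a) b + mul a (N b) - N (mul a b))

/-- The product deformed by a map `P`: `a ·_P b = P(a)·b + a·P(b) − P(a·b)`. -/
def deformMul {A : Type*} [AddCommGroup A] (mul : A → A → A) (P : A → A) : A → A → A :=
  fun a b => mul (P a) b + mul a (P b) - P (mul a b)

section

variable {K A : Type*} [Field K] [AddCommGroup A] [Module K A] (mul : A →ₗ[K] A →ₗ[K] A)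

/-- `P` and `Q` satisfy the mixed Nijenhuis identity
`P a · Q b = P (a · Q b) + Q (P a · b) - P (Q (a · b))`. -/
def MixedNijenhuis (P Q : Module.End K A) : Prop :=
  ∀ a b : A, mul (P a) (Q b) = P (mul a (Q b)) + Q (mul (P a) b) - P (Q (mul a b))

variable {mul}

lemma MixedNijenhuis.mul_left {P P' Q : Module.End K A} (hPQ : Commute P Q)
    (h : MixedNijenhuis mul P Q) (h' : MixedNijenhuis mul P' Q) :
    MixedNijenhuis mul (P * P') Q := by
  intro a b
  have hc : ∀ x, P (Q x) = Q (P x) := fun x => LinearMap.congr_fun hPQ.eq x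
  simp only [Module.End.mul_apply]
  rw [h (P' a) b, h' a b]
  simp only [map_add, map_sub, hc]
  abel

lemma MixedNijenhuis.mul_right {P Q Q' : Module.End K A} (hPQ : Commute P Q)
    (h : MixedNijenhuis mul P Q) (h' : MixedNijenhuis mul P Q') :
    MixedNijenhuis mul P (Q * Q') := by
  intro a b
  have hc : ∀ x, P (Q x) = Q (P x) := fun x => LinearMap.congr_fun hPQ.eq x
  simp only [Module.End.mul_apply]
  rw [h a (Q' b), h' a b]
  simp only [map_add, map_sub, hc]
  abel

lemma MixedNijenhuis.pow {N : Module.End K A} (h : MixedNijenhuis mul N N) (k l : ℕ) :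
    MixedNijenhuis mul (N ^ k) (N ^ l) := by
  have hl : MixedNijenhuis mul N (N ^ l) := by
    induction l with
    | zero => intro a b; simp
    | succ l ih =>
      rw [pow_succ']
      exact h.mul_right (Commute.refl N) ih
  induction k with
  | zero => intro a b; simp
  | succ k ih =>
    rw [pow_succ']
    exact hl.mul_left (Commute.self_pow N l) ih

lemma IsNijenhuis.mixedNijenhuis {N : Module.End K A}
    (h : IsNijenhuis (fun a b => mul a b) N) : MixedNijenhuis mul N N := by
  intro a b
  refine (h a b).trans ?_
  simp only [map_add, map_sub]
  abel

lemma MixedNijenhuis.antiFlexible_deformMul {P : Module.End K A} (h : MixedNijenhuis mul P P)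
    (hA : AntiFlexible fun a b => mul a b) :
    AntiFlexible (deformMul (fun a b => mul a b) P) := by
  have assoc : ∀ a b c : A,
      deformMul (fun a b => mul a b) P (deformMul (fun a b => mul a b) P a b) c -
        deformMul (fun a b => mul a b) P a (deformMul (fun a b => mul a b) P b c) =
      (mul (mul (P a) (P b)) c - mul (P a) (mul (P b) c)) +
      (mul (mul (P a) b) (P c) - mul (P a) (mul b (P c))) +
      (mul (mul a (P b)) (P c) - mul a (mul (P b) (P c))) -
      P ((mul (mul (P a) b) c - mul (P a) (mul b c)) +
        (mul (mul a (P b)) c - mul a (mul (P b) c)) +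
        (mul (mul a b) (P c) - mul a (mul b (P c)))) +
      P (P (mul (mul a b) c - mul a (mul b c))) := by
    intro a b c
    simp only [deformMul, map_add, map_sub, LinearMap.add_apply, LinearMap.sub_apply,
      h a b, h b c, h (mul a b) c, h a (mul b c)]
    abel
  intro a b c
  rw [assoc a b c, assoc c b a, hA (P a) (P b) c, hA (P a) b (P c), hA a (P b) (P c),
    hA (P a) b c, hA a (P b) c, hA a b (P c), hA a b c]
  simp only [map_add, map_sub]
  abel

lemma MixedNijenhuis.deformMul_deformMul {P Q : Module.End K A} (hPQ : Commute P Q)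
    (h : MixedNijenhuis mul P Q) (h' : MixedNijenhuis mul Q P) (a b : A) :
    deformMul (deformMul (fun a b => mul a b) P) Q a b =
      deformMul (fun a b => mul a b) (P * Q : Module.End K A) a b := by
  have hc : ∀ x, Q (P x) = P (Q x) := fun x => (LinearMap.congr_fun hPQ.eq x).symm
  simp only [deformMul, Module.End.mul_apply, map_add, map_sub, h a b, h' a b, hc]
  abel

lemma MixedNijenhuis.isNijenhuis_deformMul {P Q : Module.End K A} (hPQ : Commute P Q)
    (h : MixedNijenhuis mul P Q) (h' : MixedNijenhuis mul Q P) (hQ : MixedNijenhuis mul Q Q) :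
    IsNijenhuis (deformMul (fun a b => mul a b) P) Q := by
  intro a b
  have hc : ∀ x, Q (P x) = P (Q x) := fun x => (LinearMap.congr_fun hPQ.eq x).symm
  change _ = Q (deformMul (deformMul (fun a b => mul a b) P) Q a b)
  rw [h.deformMul_deformMul hPQ h']
  have h₁ := h.mul_left hPQ hQ a b
  have h₂ := h'.mul_right hPQ.symm hQ a b
  simp only [Module.End.mul_apply] at h₁ h₂
  simp only [deformMul, Module.End.mul_apply, map_add, map_sub, h₁, h₂, hQ a b, hc]
  abel

end

/-- if `N` is a Nijenhuis operator on an anti-flexible algebra `(A, ·)`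
then `(A, ·_{N^k})` is anti-flexible, `N^l` is a Nijenhuis operator on `(A, ·_{N^k})`,
and the deformation of `·_{N^k}` by `N^l` is `·_{N^{k+l}}`. -/
theorem nijenhuis_power_deform {K A : Type*} [Field K]
    [AddCommGroup A] [Module K A]
    (mul : A →ₗ[K] A →ₗ[K] A) (hA : AntiFlexible fun a b => mul a b)
    (N : Module.End K A) (hN : IsNijenhuis (fun a b => mul a b) N)
    (k l : ℕ) :
    AntiFlexible (deformMul (fun a b => mul a b) ⇑(N ^ k)) ∧
    IsNijenhuis (deformMul (fun a b => mul a b) ⇑(N ^ k)) ⇑(N ^ l) ∧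
    (∀ a b : A,
      deformMul (deformMul (fun a b => mul a b) ⇑(N ^ k)) ⇑(N ^ l) a b =
        deformMul (fun a b => mul a b) ⇑(N ^ (k + l)) a b) := by
  have h := hN.mixedNijenhuis.pow
  have hc : Commute (N ^ k) (N ^ l) := Commute.pow_pow_self N k l
  refine ⟨(h k k).antiFlexible_deformMul hA,
    (h k l).isNijenhuis_deformMul hc (h l k) (h l l), fun a b => ?_⟩
  rw [pow_add]
  exact (h k l).deformMul_deformMul hc (h l k) a b
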